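/- arXiv:1504.06242 — 2 statements merged into one kernel-verified Lean document; each statement's English description precedes it below -/
import Mathlib

section
/- Let X be a suffix of a string Y. Let ρ_X be the minimal period of X and ρ_Y the minimal period of Y, and suppose ρ_X + ρ_Y ≤ |X|. Then ρ_X = ρ_Y. -/
/-- `U` occurs in `T` at position `q` (0-indexed): the substring of `T` of length
`|U|` starting at position `q` equals `U`. -/
def occursAt {α : Type*} (U T : List α) (q : ℕ) : Prop :=
  (T.drop q).take U.length = U

/-- `q` is a period of the string `x`. -/
def IsPeriod {α : Type*} (x : List α) (q : ℕ) : Prop :=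
  0 < q ∧ q ≤ x.length ∧ ∀ i, i + q < x.length → x[i]? = x[i + q]?

/-- The minimal period of `x`. -/
noncomputable def minPeriod {α : Type*} (x : List α) : ℕ :=
  sInf {q | IsPeriod x q}

theorem IsPeriod.minPeriod_le {α : Type*} {x : List α} {q : ℕ} (h : IsPeriod x q) :
    minPeriod x ≤ q :=
  Nat.sInf_le h

theorem isPeriod_minPeriod {α : Type*} {x : List α} (hx : 0 < x.length) :
    IsPeriod x (minPeriod x) :=
  Nat.sInf_mem (s := {q | IsPeriod x q}) ⟨x.length, hx, le_rfl, fun i hi => by omega⟩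

/-- A period of `W ++ X` not exceeding the length of `X` is a period of `X`. -/
theorem IsPeriod.of_append {α : Type*} {W X : List α} {q : ℕ}
    (h : IsPeriod (W ++ X) q) (hq : q ≤ X.length) : IsPeriod X q := by
  refine ⟨h.1, hq, fun i hi => ?_⟩
  have key := h.2.2 (W.length + i) (by rw [List.length_append]; omega)
  rwa [Nat.add_assoc, List.getElem?_append_right (Nat.le_add_right _ _),
    List.getElem?_append_right (Nat.le_add_right _ _), Nat.add_sub_cancel_left,
    Nat.add_sub_cancel_left] at key

/-- A period `p` of `X` extends to `W ++ X` if `W ++ X` has a period `q` with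
`p + q ≤ |X|`. -/
theorem IsPeriod.append {α : Type*} {W X : List α} {p q : ℕ}
    (hp : IsPeriod X p) (hq : IsPeriod (W ++ X) q) (hpq : p + q ≤ X.length) :
    IsPeriod (W ++ X) p := by
  have hlen : (W ++ X).length = W.length + X.length := List.length_append
  refine ⟨hp.1, by omega, fun i => ?_⟩
  induction hn : W.length - i using Nat.strong_induction_on generalizing i with
  | _ n ih =>
    intro hi
    by_cases hiW : W.length ≤ i
    · rw [List.getElem?_append_right hiW, List.getElem?_append_right (by omega),
        hp.2.2 (i - W.length) (by omega)]
      congr 1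
      omega
    · have hq0 := hq.1
      have shifted := ih (W.length - (i + q)) (by omega) (i + q) rfl (by omega)
      rw [hq.2.2 i (by omega), shifted, hq.2.2 (i + p) (by omega), Nat.add_right_comm]

theorem suffix_minimal_periods_equal {α : Type*} (X Y : List α) (hsuf : X <:+ Y)
    (h : minPeriod X + minPeriod Y ≤ X.length) :
    minPeriod X = minPeriod Y := by
  obtain ⟨W, rfl⟩ := hsuf
  rcases Nat.eq_zero_or_pos X.length with hX | hX
  · omega
  · have hpX := isPeriod_minPeriod hX
    have hpY : IsPeriod (W ++ X) (minPeriod (W ++ X)) :=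
      isPeriod_minPeriod (by rw [List.length_append]; omega)
    exact le_antisymm (hpY.of_append (by omega)).minPeriod_le
      (hpX.append hpY h).minPeriod_le
end

section
/- Let Q be a string with period ρ, let K be the prefix of Q of length L with ρ ≤ L ≤ |Q|, let S be the suffix of Q of length L, and set c = ⌊(|Q| − L)/ρ⌋ + 1. Suppose that in a string T (positions 0-indexed) K occurs at each position x + jρ for j = 0, 1, …, c−1, and S occurs at position x + |Q| − L. Then Q occurs in T at position x. -/
theorem occursAt_iff_getElem? {α : Type*} {U T : List α} {q : ℕ} :
    occursAt U T q ↔ ∀ i < U.length, T[q + i]? = U[i]? := by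
  unfold occursAt
  constructor
  · intro h i hi
    rw [← congrArg (·[i]?) h]
    simp [hi]
  · intro h
    refine List.ext_getElem? fun i ↦ ?_
    rcases lt_or_ge i U.length with hi | hi
    · simpa [hi] using h i hi
    · simp [hi]

theorem IsPeriod.getElem?_add_mul {α : Type*} {Q : List α} {ρ : ℕ} (h : IsPeriod Q ρ)
    {i j : ℕ} (hij : i + j * ρ < Q.length) : Q[i + j * ρ]? = Q[i]? := by
  induction j with
  | zero => simp
  | succ j ih =>
    rw [Nat.succ_mul, ← add_assoc] at hij ⊢
    rw [← h.2.2 _ hij, ih (by omega)]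

theorem stitch_periodic_occurrences {α : Type*} (Q T : List α) (ρ L x : ℕ)
    (hper : IsPeriod Q ρ) (hρL : ρ ≤ L) (hLQ : L ≤ Q.length)
    (hK : ∀ j : ℕ, j < (Q.length - L) / ρ + 1 → occursAt (Q.take L) T (x + j * ρ))
    (hS : occursAt (Q.drop (Q.length - L)) T (x + (Q.length - L))) :
    occursAt Q T x := by
  refine occursAt_iff_getElem?.2 fun i hi ↦ ?_
  rcases lt_or_ge i (Q.length - L) with hin | hin
  · have hj : i / ρ < (Q.length - L) / ρ + 1 := Nat.lt_succ_of_le (Nat.div_le_div_right hin.le)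
    have hmod : i % ρ < L := (Nat.mod_lt i hper.1).trans_le hρL
    have hdecomp : i % ρ + i / ρ * ρ = i := Nat.mod_add_div' i ρ
    have hT := occursAt_iff_getElem?.1 (hK _ hj) (i % ρ) (by simp; omega)
    have hQ := hper.getElem?_add_mul (hdecomp.symm ▸ hi)
    rw [hdecomp] at hQ
    rwa [add_assoc, add_comm (i / ρ * ρ), hdecomp, List.getElem?_take_of_lt hmod, ← hQ] at hT
  · have hT := occursAt_iff_getElem?.1 hS (i - (Q.length - L)) (by simp; omega)
    rwa [List.getElem?_drop, add_assoc, Nat.add_sub_cancel' hin] at hT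
end
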